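/- Let X be a compact metric space and f : X → X a homeomorphism with finite non-wandering set. Then for all n ≥ 2, the polynomial entropy of the induced map on the n-fold symmetric product suspension satisfies h_pol(S F_n(f)) = n · h_pol(f). -/

import Mathlib

open Filter Topology Set

section PolEnt

variable {X : Type*} [MetricSpace X]

/-- `E` is `(n,ε)`-separated for the dynamic metric of `f`. -/
def IsDynSep (f : X → X) (n : ℕ) (ε : ℝ) (E : Set X) : Prop :=
  ∀ x ∈ E, ∀ y ∈ E, x ≠ y → ∃ j < n, ε ≤ dist (f^[j] x) (f^[j] y)

/-- Maximal cardinality of an `(n,ε)`-separated set contained in `Y`. -/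
noncomputable def dynSepMax (f : X → X) (Y : Set X) (n : ℕ) (ε : ℝ) : ℕ :=
  sSup {k | ∃ E : Finset X, ↑E ⊆ Y ∧ IsDynSep f n ε ↑E ∧ E.card = k}

/-- Polynomial entropy of `f` on the set `Y`:
`lim_{ε→0} limsup_n log S(n,ε;Y)/log n`, expressed as a supremum over `ε > 0`
(the function is antitone in `ε`, so the limit as `ε → 0⁺` is this supremum). -/
noncomputable def polEntropyOn (f : X → X) (Y : Set X) : ENNReal :=
  ⨆ (ε : ℝ) (_ : 0 < ε),
    Filter.limsup (fun n : ℕ =>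
      ENNReal.ofReal (Real.log (dynSepMax f Y n ε) / Real.log n)) Filter.atTop

/-- Polynomial entropy of `f`. -/
noncomputable def polEntropy (f : X → X) : ENNReal := polEntropyOn f Set.univ

end PolEnt
open TopologicalSpace

/-- The `n`-fold symmetric product: nonempty subsets of `X` with at most `n` points,
viewed inside the hyperspace of nonempty compact subsets with the Hausdorff metric. -/
def symProd (X : Type*) [MetricSpace X] (n : ℕ) : Set (NonemptyCompacts X) :=
  {A | (A : Set X).Finite ∧ (A : Set X).ncard ≤ n}

/-- The induced map `F_n(f)` on the symmetric product, `A ↦ f(A)`. -/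
noncomputable def symProdMap {X : Type*} [MetricSpace X] {f : X → X} (hf : Continuous f)
    (n : ℕ) (A : symProd X n) : symProd X n :=
  ⟨⟨⟨f '' (A : Set X), (A.1.isCompact.image hf)⟩, A.1.nonempty.image f⟩,
    A.2.1.image f, (Set.ncard_image_le A.2.1).trans A.2.2⟩


/-- The set of non-wandering points of `f`. -/
def nonWanderingSet {X : Type*} [TopologicalSpace X] (f : X → X) : Set X :=
  {x | ∀ U ∈ nhds x, ∃ n, 1 ≤ n ∧ ((f^[n]) '' U ∩ U).Nonempty}

theorem bddAbove_card_isDynSep {X : Type*} [MetricSpace X] [CompactSpace X] {f : X → X}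
    (hf : Continuous f) (N : ℕ) {ε : ℝ} (hε : 0 < ε) (Y : Set X) :
    BddAbove {k | ∃ E : Finset X, ↑E ⊆ Y ∧ IsDynSep f N ε ↑E ∧ E.card = k} := by
  obtain ⟨t, ht⟩ := (isCompact_univ (X := X)).elim_nhds_subcover
    (fun x => {y | ∀ j : Fin N, dist (f^[j] y) (f^[j] x) < ε / 2}) (fun x _ => by
      have hopen : IsOpen {y | ∀ j : Fin N, dist (f^[j] y) (f^[j] x) < ε / 2} := by
        rw [ofPred_forall]
        exact isOpen_iInter_of_finite fun j =>
          isOpen_lt ((hf.iterate j).dist continuous_const) continuous_const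
      exact hopen.mem_nhds fun j => by simpa using half_pos hε)
  refine ⟨t.card, ?_⟩
  rintro k ⟨E, -, hE, rfl⟩
  have H : ∀ y : X, ∃ x ∈ t, ∀ j : Fin N, dist (f^[j] y) (f^[j] x) < ε / 2 := fun y => by
    simpa using ht.2 (mem_univ y)
  choose c hct hc using H
  refine Finset.card_le_card_of_injOn c (fun y _ => hct y) fun y hy y' hy' hyy => ?_
  by_contra hne
  obtain ⟨j, hj, hd⟩ := hE y hy y' hy' hne
  have h1 := hc y ⟨j, hj⟩
  have h2 := hc y' ⟨j, hj⟩
  rw [hyy] at h1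
  have := dist_triangle_right (f^[j] y) (f^[j] y') (f^[j] (c y'))
  simp only at h1 h2
  linarith

theorem exists_isDynSep_card_eq_dynSepMax {X : Type*} [MetricSpace X] {f : X → X} {Y : Set X}
    {N : ℕ} {ε : ℝ} (hε : 0 < ε)
    (hb : BddAbove {k | ∃ E : Finset X, ↑E ⊆ Y ∧ IsDynSep f N ε ↑E ∧ E.card = k}) :
    ∃ E : Finset X, ↑E ⊆ Y ∧ IsDynSep f N ε ↑E ∧ E.card = dynSepMax f Y N ε ∧
      ∀ y ∈ Y, ∃ e ∈ E, ∀ j < N, dist (f^[j] y) (f^[j] e) < ε := by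
  classical
  obtain ⟨E, hEY, hE, hcard⟩ := Nat.sSup_mem
    (s := {k | ∃ E : Finset X, ↑E ⊆ Y ∧ IsDynSep f N ε ↑E ∧ E.card = k})
    ⟨0, ∅, by simp, by simp [IsDynSep], by simp⟩ hb
  refine ⟨E, hEY, hE, hcard, fun y hy => ?_⟩
  by_contra! hcon
  have hyE : y ∉ E := fun h => by
    obtain ⟨j, -, hd⟩ := hcon y h
    rw [dist_self] at hd
    exact hd.not_gt hε
  have hmem : (insert y E).card ∈
      {k | ∃ E : Finset X, ↑E ⊆ Y ∧ IsDynSep f N ε ↑E ∧ E.card = k} := by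
    refine ⟨insert y E, ?_, ?_, rfl⟩
    · simpa [insert_subset_iff] using ⟨hy, hEY⟩
    · intro a ha b hb hab
      simp only [Finset.coe_insert, mem_insert_iff, Finset.mem_coe] at ha hb
      rcases ha with rfl | ha <;> rcases hb with rfl | hb
      · exact absurd rfl hab
      · obtain ⟨j, hj, hd⟩ := hcon b hb
        exact ⟨j, hj, hd⟩
      · obtain ⟨j, hj, hd⟩ := hcon a ha
        exact ⟨j, hj, by rwa [dist_comm]⟩
      · exact hE a ha b hb hab
  have := le_csSup hb hmem
  rw [Finset.card_insert_of_notMem hyE, ← hcard] at this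
  omega

theorem exists_ncard_far_from_nonWanderingSet_le {X : Type*} [MetricSpace X] [CompactSpace X]
    (f : X → X) {δ : ℝ} (hδ : 0 < δ) :
    ∃ M : ℕ, ∀ x, {j : ℕ | ∀ p ∈ nonWanderingSet f, δ ≤ dist (f^[j] x) p}.Finite ∧
      {j : ℕ | ∀ p ∈ nonWanderingSet f, δ ≤ dist (f^[j] x) p}.ncard ≤ M := by
  have hK : IsCompact {z : X | ∀ p ∈ nonWanderingSet f, δ ≤ dist z p} := by
    refine IsClosed.isCompact ?_
    simp only [ofPred_forall]
    exact isClosed_iInter fun p => isClosed_iInter fun _ =>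
      isClosed_le continuous_const (continuous_id.dist continuous_const)
  have hW : ∀ z : X, ∃ U ∈ 𝓝 z, (∀ p ∈ nonWanderingSet f, δ ≤ dist z p) →
      ∀ k, 1 ≤ k → ¬ ((f^[k]) '' U ∩ U).Nonempty := by
    intro z
    by_cases hz : ∀ p ∈ nonWanderingSet f, δ ≤ dist z p
    · have : z ∉ nonWanderingSet f := fun h => by
        have := hz z h
        rw [dist_self] at this
        linarith
      simp only [nonWanderingSet, mem_ofPred_eq] at this
      push Not at this
      obtain ⟨U, hU, h⟩ := this
      exact ⟨U, hU, fun _ k hk => h k hk ▸ not_nonempty_empty⟩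
    · exact ⟨univ, univ_mem, fun h => absurd h hz⟩
  choose U hU hUw using hW
  obtain ⟨t, htK, ht⟩ := hK.elim_nhds_subcover U fun z _ => hU z
  refine ⟨t.card, fun x => ?_⟩
  have H : ∀ j : ℕ, ∃ z, (∀ p ∈ nonWanderingSet f, δ ≤ dist (f^[j] x) p) →
      z ∈ t ∧ f^[j] x ∈ U z := by
    intro j
    by_cases hj : ∀ p ∈ nonWanderingSet f, δ ≤ dist (f^[j] x) p
    · obtain ⟨z, hz, hz'⟩ := mem_iUnion₂.1 (ht hj)
      exact ⟨z, fun _ => ⟨hz, hz'⟩⟩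
    · exact ⟨x, fun h => absurd h hj⟩
  choose c hc using H
  have key : ∀ j k : ℕ, (∀ p ∈ nonWanderingSet f, δ ≤ dist (f^[j] x) p) →
      (∀ p ∈ nonWanderingSet f, δ ≤ dist (f^[k] x) p) → c j = c k → ¬ j < k := by
    intro j k hj hk hjk hlt
    refine hUw (c j) (htK _ (hc j hj).1) (k - j) (by omega) ⟨f^[k] x, ⟨f^[j] x, (hc j hj).2, ?_⟩, ?_⟩
    · rw [← Function.iterate_add_apply, Nat.sub_add_cancel hlt.le]
    · rw [hjk]
      exact (hc k hk).2
  have hinj : InjOn c {j : ℕ | ∀ p ∈ nonWanderingSet f, δ ≤ dist (f^[j] x) p} := by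
    intro j hj k hk hjk
    have h1 := key j k hj hk hjk
    have h2 := key k j hk hj hjk.symm
    omega
  have hmaps : MapsTo c {j : ℕ | ∀ p ∈ nonWanderingSet f, δ ≤ dist (f^[j] x) p} (t : Set X) :=
    fun j hj => (hc j hj).1
  refine ⟨Finite.of_injOn hmaps hinj t.finite_toSet, ?_⟩
  rw [← ncard_coe_finset t]
  exact ncard_le_ncard_of_injOn c hmaps hinj t.finite_toSet

/-- A dynamically separated set all of whose orbits shadow one of `n` reference orbits at the times
in `T`, and stay near the finite set `Ω` at the other times, has bounded cardinality. -/
theorem card_le_of_shadowing {X : Type*} [MetricSpace X] {f : X → X} {Ω : Finset X}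
    {ε δ r : ℝ} (hδ : 0 < δ) (hδε : 6 * δ ≤ ε) (hδr : 12 * δ ≤ r)
    (hΩ : ∀ p ∈ Ω, ∀ p' ∈ Ω, dist p p' < r → p = p')
    (hf : ∀ a b, dist a b < 6 * δ → dist (f a) (f b) < r / 2)
    {n N : ℕ} {E : Finset X} (hE : IsDynSep f N ε (E : Set X)) (z : Fin n → X) (T : Finset ℕ)
    (hT : ∀ y ∈ E, ∀ j ∈ T, ∃ i, dist (f^[j] y) (f^[j] (z i)) < δ)
    (hΩE : ∀ y ∈ E, ∀ j < N, j ∉ T → ∃ p ∈ Ω, dist (f^[j] y) p < 3 * δ) :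
    E.card ≤ n ^ T.card * (Ω.card + 1) := by
  classical
  have H : ∀ y : E, ∃ c : (T → Fin n) × Option Ω,
      (∀ j : T, dist (f^[j] y) (f^[j] (z (c.1 j))) < δ) ∧
      (0 < N → 0 ∉ T → ∃ p : Ω, c.2 = some p ∧ dist (y : X) p < 3 * δ) := by
    intro y
    choose i hi using fun j : T => hT y y.2 j j.2
    by_cases h : 0 < N ∧ 0 ∉ T
    · obtain ⟨p, hp, hd⟩ := hΩE y y.2 0 h.1 h.2
      exact ⟨⟨i, some ⟨p, hp⟩⟩, hi, fun _ _ => ⟨⟨p, hp⟩, rfl, hd⟩⟩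
    · exact ⟨⟨i, none⟩, hi, fun h1 h2 => absurd ⟨h1, h2⟩ h⟩
  choose c hc1 hc2 using H
  have hinj : Function.Injective c := by
    intro y y' hyy
    have near : ∀ j < N, dist (f^[j] (y : X)) (f^[j] (y' : X)) < 6 * δ := by
      have hmem : ∀ j ∈ T, dist (f^[j] (y : X)) (f^[j] (y' : X)) < 6 * δ := by
        intro j hj
        have h1 := hc1 y ⟨j, hj⟩
        have h2 := hc1 y' ⟨j, hj⟩
        rw [hyy] at h1
        have := dist_triangle_right (f^[j] (y : X)) (f^[j] (y' : X))
          (f^[j] (z ((c y').1 ⟨j, hj⟩)))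
        simp only at h1 h2
        linarith
      intro j
      induction j with
      | zero =>
        intro hN
        by_cases h0 : 0 ∈ T
        · exact hmem 0 h0
        · obtain ⟨p, hp, hd⟩ := hc2 y hN h0
          obtain ⟨p', hp', hd'⟩ := hc2 y' hN h0
          rw [hyy, hp'] at hp
          obtain rfl : p' = p := by simpa using hp
          have := dist_triangle_right (y : X) (y' : X) p'
          simp only [Function.iterate_zero, id]
          linarith
      | succ j ih =>
        intro hjN
        by_cases hj : j + 1 ∈ T
        · exact hmem _ hj
        · obtain ⟨p, hp, hd⟩ := hΩE y y.2 _ hjN hj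
          obtain ⟨p', hp', hd'⟩ := hΩE y' y'.2 _ hjN hj
          have h3 := hf _ _ (ih (by omega))
          rw [← Function.iterate_succ_apply' f, ← Function.iterate_succ_apply' f] at h3
          have h4 : dist p p' < r := by
            have h5 := dist_triangle4 p (f^[j + 1] (y : X)) (f^[j + 1] (y' : X)) p'
            rw [dist_comm p (f^[j + 1] (y : X))] at h5
            simp only [Nat.succ_eq_add_one] at h3
            linarith
          obtain rfl := hΩ p hp p' hp' h4
          have := dist_triangle_right (f^[j + 1] (y : X)) (f^[j + 1] (y' : X)) p
          linarith
    by_contra hne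
    obtain ⟨j, hj, hd⟩ := hE y y.2 y' y'.2 fun h => hne (Subtype.ext h)
    linarith [near j hj]
  simpa using Fintype.card_le_of_injective c hinj

theorem mul_polEntropy_le_of_dynSepMax_pow_le {X S : Type*} [MetricSpace X] [MetricSpace S]
    {f : X → X} {g : S → S} {n : ℕ}
    (h : ∀ ε > 0, ∃ δ > 0, ∃ L K : ℕ, ∀ N,
      dynSepMax f univ N ε ^ n ≤ K * dynSepMax g univ (N + L) δ) :
    n * polEntropy f ≤ polEntropy g := by
  unfold polEntropy polEntropyOn
  simp only [ENNReal.mul_iSup]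
  refine iSup₂_le fun ε hε => ?_
  obtain ⟨δ, hδ, L, K, hLK⟩ := h ε hε
  refine le_trans ?_ (le_iSup₂ (f := fun (ε : ℝ) (_ : 0 < ε) => Filter.limsup (fun n : ℕ =>
      ENNReal.ofReal (Real.log (dynSepMax g univ n ε) / Real.log n)) Filter.atTop) δ hδ)
  rw [← ENNReal.limsup_const_mul_of_ne_top (ENNReal.natCast_ne_top n)]
  refine le_of_forall_lt fun c hc => ?_
  obtain ⟨d, hcd, hd⟩ := exists_between hc
  obtain ⟨b, hcb, hbd⟩ := exists_between hcd
  refine lt_of_lt_of_le hcb (Filter.le_limsup_of_frequently_le ?_)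
  have hfr := Filter.frequently_lt_of_lt_limsup (by isBoundedDefault) hd
  have hbt : b ≠ ⊤ := hbd.ne_top
  have hdt : d ≠ ⊤ := hd.ne_top
  have hbd' : b.toReal < d.toReal := (ENNReal.toReal_lt_toReal hbt hdt).2 hbd
  have hlog : ∀ᶠ N : ℕ in atTop, b.toReal * Real.log (1 + L) + Real.log K ≤
      (d.toReal - b.toReal) * Real.log N :=
    ((Real.tendsto_log_atTop.comp tendsto_natCast_atTop_atTop).const_mul_atTop
      (sub_pos.2 hbd')).eventually_ge_atTop _
  refine (tendsto_add_atTop_nat L).frequently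
    ((hfr.and_eventually (hlog.and (eventually_ge_atTop 2))).mono ?_)
  rintro N ⟨hN, hN1, hN2⟩
  have hNr : (2 : ℝ) ≤ N := by exact_mod_cast hN2
  have hlogN : 0 < Real.log N := Real.log_pos (by linarith)
  have hlogNL : 0 < Real.log (N + L : ℕ) := Real.log_pos (by push_cast; linarith [L.cast_nonneg (α := ℝ)])
  have hd1 : d.toReal * Real.log N < n * Real.log (dynSepMax f univ N ε) := by
    rw [← ENNReal.ofReal_natCast, ← ENNReal.ofReal_mul (by positivity),
      ENNReal.lt_ofReal_iff_toReal_lt hdt, ← mul_div_assoc, lt_div_iff₀ hlogN] at hN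
    exact hN
  have hSf : 0 < dynSepMax f univ N ε := by
    rcases Nat.eq_zero_or_pos (dynSepMax f univ N ε) with h0 | h0
    · rw [h0] at hd1
      have : 0 ≤ d.toReal * Real.log N := by positivity
      simp at hd1
      linarith
    · exact h0
  have hle := hLK N
  have hprod : 0 < K * dynSepMax g univ (N + L) δ := (pow_pos hSf n).trans_le hle
  have hK : 0 < K := Nat.pos_of_mul_pos_right hprod
  have hSg : 0 < dynSepMax g univ (N + L) δ := Nat.pos_of_mul_pos_left hprod
  have hlogle : n * Real.log (dynSepMax f univ N ε) ≤
      Real.log K + Real.log (dynSepMax g univ (N + L) δ) := by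
    rw [← Real.log_pow, ← Real.log_mul (by positivity) (by positivity)]
    exact Real.log_le_log (by positivity) (by exact_mod_cast hle)
  have hshift : Real.log (N + L : ℕ) ≤ Real.log N + Real.log (1 + L) := by
    rw [← Real.log_mul (by positivity) (by positivity)]
    refine Real.log_le_log (by positivity) ?_
    push_cast
    nlinarith [L.cast_nonneg (α := ℝ)]
  rw [← ENNReal.ofReal_toReal hbt]
  refine ENNReal.ofReal_le_ofReal ?_
  rw [le_div_iff₀ hlogNL]
  have := mul_le_mul_of_nonneg_left hshift (ENNReal.toReal_nonneg (a := b))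
  nlinarith

theorem polEntropy_le_mul_of_dynSepMax_le_pow {X S : Type*} [MetricSpace X] [MetricSpace S]
    {f : X → X} {g : S → S} {n : ℕ}
    (h : ∀ ε > 0, ∃ δ > 0, ∀ N, dynSepMax g univ N ε ≤ dynSepMax f univ N δ ^ n) :
    polEntropy g ≤ n * polEntropy f := by
  unfold polEntropy polEntropyOn
  simp only [ENNReal.mul_iSup]
  refine iSup₂_le fun ε hε => ?_
  obtain ⟨δ, hδ, hle⟩ := h ε hε
  refine le_trans ?_ (le_iSup₂ (f := fun (ε : ℝ) (_ : 0 < ε) => n * Filter.limsup (fun n : ℕ =>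
      ENNReal.ofReal (Real.log (dynSepMax f univ n ε) / Real.log n)) Filter.atTop) δ hδ)
  rw [← ENNReal.limsup_const_mul_of_ne_top (ENNReal.natCast_ne_top n)]
  refine Filter.limsup_le_limsup (Eventually.of_forall fun N => ?_)
  beta_reduce
  rw [← ENNReal.ofReal_natCast n, ← ENNReal.ofReal_mul (by positivity), ← mul_div_assoc,
    ← Real.log_pow]
  refine ENNReal.ofReal_le_ofReal ?_
  refine div_le_div_of_nonneg_right ?_ (Real.log_natCast_nonneg N)
  rcases Nat.eq_zero_or_pos (dynSepMax g univ N ε) with h0 | h0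
  · rw [h0]
    have := Real.log_natCast_nonneg (dynSepMax f univ N δ ^ n)
    simpa using this
  · exact Real.log_le_log (by exact_mod_cast h0) (by exact_mod_cast hle N)

theorem exists_iterate_disjoint_visits {X : Type*} {f : X → X} {P : X → Prop} {M : ℕ}
    (hM : ∀ x, {j : ℕ | P (f^[j] x)}.Finite ∧ {j : ℕ | P (f^[j] x)}.ncard ≤ M) (x y : X) :
    ∃ t < M * M + 1, ∀ j, ¬ (P (f^[j] x) ∧ P (f^[j] (f^[t] y))) := by
  classical
  have hcard : ((hM x).1.toFinset.image₂ (fun j k => k - j) (hM y).1.toFinset).card <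
      (Finset.range (M * M + 1)).card := by
    refine (Finset.card_image₂_le _ _ _).trans_lt ?_
    rw [Finset.card_range, ← ncard_eq_toFinset_card _ (hM x).1, ← ncard_eq_toFinset_card _ (hM y).1]
    exact Nat.lt_succ_of_le (Nat.mul_le_mul (hM x).2 (hM y).2)
  obtain ⟨t, ht, htn⟩ := Finset.exists_mem_notMem_of_card_lt_card hcard
  refine ⟨t, Finset.mem_range.1 ht, fun j hj => htn ?_⟩
  refine Finset.mem_image₂.2 ⟨j, by simpa using hj.1, j + t, ?_, by simp⟩
  simpa [Function.iterate_add_apply] using hj.2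

theorem exists_dist_lt_of_quotient_dist_lt {X S : Type*} [MetricSpace X] [CompactSpace X]
    [MetricSpace S] {n : ℕ} {π : (Fin n → X) → S} (hπ : Continuous π)
    (hfib : ∀ z z', π z = π z' →
      range z = range z' ∨ ((range z).Subsingleton ∧ (range z').Subsingleton))
    {δ : ℝ} (hδ : 0 < δ) :
    ∃ δ' > 0, ∀ z z', dist (π z) (π z') < δ' →
      (∀ i, ∃ k, dist (z' i) (z k) < δ) ∨
        ∀ i k, dist (z i) (z k) < δ ∧ dist (z' i) (z' k) < δ := by
  have hclosed : IsClosed {a : (Fin n → X) × (Fin n → X) |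
      (∃ i, ∀ k, δ ≤ dist (a.2 i) (a.1 k)) ∧
        ∃ i k, δ ≤ dist (a.1 i) (a.1 k) ∨ δ ≤ dist (a.2 i) (a.2 k)} := by
    simp only [ofPred_and, ofPred_exists, ofPred_forall, ofPred_or]
    refine IsClosed.inter (isClosed_iUnion_of_finite fun i => isClosed_iInter fun k => ?_)
      (isClosed_iUnion_of_finite fun i => isClosed_iUnion_of_finite fun k => IsClosed.union ?_ ?_)
    all_goals exact isClosed_le continuous_const (by fun_prop)
  obtain hemp | hne := eq_empty_or_nonempty {a : (Fin n → X) × (Fin n → X) |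
      (∃ i, ∀ k, δ ≤ dist (a.2 i) (a.1 k)) ∧
        ∃ i k, δ ≤ dist (a.1 i) (a.1 k) ∨ δ ≤ dist (a.2 i) (a.2 k)}
  · refine ⟨1, one_pos, fun z z' _ => ?_⟩
    by_contra! hcon
    obtain ⟨h1, i, k, h2⟩ := hcon
    refine (eq_empty_iff_forall_notMem.1 hemp) (z, z') ⟨h1, i, k, ?_⟩
    by_cases h : dist (z i) (z k) < δ
    · exact Or.inr (h2 h)
    · exact Or.inl (not_lt.1 h)
  · obtain ⟨a, ha, hmin⟩ := hclosed.isCompact.exists_isMinOn hne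
      (f := fun a => dist (π a.1) (π a.2)) (by fun_prop)
    refine ⟨dist (π a.1) (π a.2), dist_pos.2 fun heq => ?_, fun z z' hz => ?_⟩
    · obtain ⟨⟨i, hi⟩, i', k', hik⟩ := ha
      rcases hfib _ _ heq with h | ⟨h1, h2⟩
      · obtain ⟨k, hk⟩ : a.2 i ∈ range a.1 := h ▸ mem_range_self i
        have := hi k
        rw [hk, dist_self] at this
        linarith
      · rw [h1 (mem_range_self i') (mem_range_self k'), h2 (mem_range_self i') (mem_range_self k'),
          dist_self, dist_self] at hik
        rcases hik with h | h <;> linarith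
    · by_contra! hcon
      obtain ⟨h1, i, k, h2⟩ := hcon
      refine (isMinOn_iff.1 hmin (z, z') ⟨h1, i, k, ?_⟩).not_gt hz
      by_cases h : dist (z i) (z k) < δ
      · exact Or.inr (h2 h)
      · exact Or.inl (not_lt.1 h)

theorem iterate_apply_of_power_semiconj {X S ι : Type*} {f : X → X} {g : S → S}
    {π : (ι → X) → S} (hg : ∀ z, g (π z) = π fun i => f (z i)) (j : ℕ) (z : ι → X) :
    g^[j] (π z) = π fun i => f^[j] (z i) := by
  induction j generalizing z with
  | zero => rfl
  | succ j ih => rw [Function.iterate_succ_apply, hg, ih]; rfl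

theorem exists_card_le_dynSepMax_pow {X S : Type*} [MetricSpace X] [CompactSpace X]
    [MetricSpace S] {f : X → X} (hf : Continuous f) {g : S → S} {n : ℕ}
    {π : (Fin n → X) → S} (hπ : Continuous π) (hsurj : Function.Surjective π)
    (hg : ∀ z, g (π z) = π fun i => f (z i)) {ε : ℝ} (hε : 0 < ε) :
    ∃ δ > 0, ∀ N, ∀ F : Finset S, IsDynSep g N ε (F : Set S) →
      F.card ≤ dynSepMax f univ N δ ^ n := by
  classical
  obtain ⟨δ, hδ, hπδ⟩ := Metric.uniformContinuous_iff.1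
    (CompactSpace.uniformContinuous_of_continuous hπ) ε hε
  refine ⟨δ / 2, half_pos hδ, fun N F hF => ?_⟩
  obtain ⟨E, -, -, hcard, hspan⟩ := exists_isDynSep_card_eq_dynSepMax (half_pos hδ)
    (bddAbove_card_isDynSep hf N (half_pos hδ) univ)
  choose e heE he using fun x => hspan x (mem_univ x)
  choose σ hσ using hsurj
  have hmaps : ∀ s ∈ F, (fun i => e (σ s i)) ∈ Fintype.piFinset fun _ : Fin n => E :=
    fun s _ => Fintype.mem_piFinset.2 fun i => heE _
  have := Finset.card_le_card_of_injOn (fun s i => e (σ s i)) hmaps ?_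
  · simpa [hcard] using this
  intro s hs s' hs' hss
  by_contra hne
  obtain ⟨j, hj, hd⟩ := hF s hs s' hs' hne
  rw [← hσ s, ← hσ s', iterate_apply_of_power_semiconj hg,
    iterate_apply_of_power_semiconj hg] at hd
  refine hd.not_gt (hπδ ((dist_pi_lt_iff hδ).2 fun i => ?_))
  have h1 := he (σ s i) j hj
  have h2 := he (σ s' i) j hj
  rw [show e (σ s i) = e (σ s' i) from congrFun hss i] at h1
  have := dist_triangle_right (f^[j] (σ s i)) (f^[j] (σ s' i)) (f^[j] (e (σ s' i)))
  linarith

theorem Finset.exists_pos_forall_dist_lt_imp_eq {X : Type*} [MetricSpace X] (Ω : Finset X) :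
    ∃ r > 0, ∀ p ∈ Ω, ∀ p' ∈ Ω, dist p p' < r → p = p' := by
  have H : ∀ᶠ r : ℝ in 𝓝[>] 0, ∀ p ∈ Ω, ∀ p' ∈ Ω, dist p p' < r → p = p' := by
    refine (Filter.eventually_all_finset Ω).2 fun p _ =>
      (Filter.eventually_all_finset Ω).2 fun p' _ => ?_
    by_cases hpp : p = p'
    · exact Eventually.of_forall fun _ _ => hpp
    · filter_upwards [nhdsWithin_le_nhds (gt_mem_nhds (dist_pos.2 hpp))] with r hr hr'
      exact absurd hr hr'.not_gt
  obtain ⟨r, hr, hr0⟩ := (H.and self_mem_nhdsWithin).exists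
  exact ⟨r, hr0, hr⟩

theorem exists_dynSepMax_pow_le {X S : Type*} [MetricSpace X] [CompactSpace X]
    [MetricSpace S] (f : X ≃ₜ X) (hfin : (nonWanderingSet (f : X → X)).Finite) {g : S → S}
    {n : ℕ} {i₀ i₁ : Fin n} (hi : i₀ ≠ i₁)
    {π : (Fin n → X) → S} (hπ : Continuous π)
    (hfib : ∀ z z', π z = π z' →
      range z = range z' ∨ ((range z).Subsingleton ∧ (range z').Subsingleton))
    (hg : ∀ z, g (π z) = π fun i => f (z i))
    (hb : ∀ N, ∀ ε > 0, ∀ Y : Set S, BddAbove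
      {k | ∃ E : Finset S, ↑E ⊆ Y ∧ IsDynSep g N ε ↑E ∧ E.card = k})
    {ε : ℝ} (hε : 0 < ε) :
    ∃ δ > 0, ∃ L K : ℕ, ∀ N,
      dynSepMax f univ N ε ^ n ≤ K * dynSepMax g univ (N + L) δ := by
  classical
  obtain ⟨r, hr, hΩ⟩ := hfin.toFinset.exists_pos_forall_dist_lt_imp_eq
  obtain ⟨η, hη, hfη⟩ := Metric.uniformContinuous_iff.1
    (CompactSpace.uniformContinuous_of_continuous f.continuous) (r / 2) (half_pos hr)
  obtain ⟨δ, hδ, hδε, hδr, hδη⟩ : ∃ δ > 0, 6 * δ ≤ ε ∧ 12 * δ ≤ r ∧ 6 * δ ≤ η := by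
    refine ⟨min (min (ε / 6) (r / 12)) (η / 6), by positivity, ?_, ?_, ?_⟩
    · linarith [(min_le_left (min (ε / 6) (r / 12)) (η / 6)).trans (min_le_left _ _)]
    · linarith [(min_le_left (min (ε / 6) (r / 12)) (η / 6)).trans (min_le_right _ _)]
    · linarith [min_le_right (min (ε / 6) (r / 12)) (η / 6)]
  obtain ⟨M, hM⟩ := exists_ncard_far_from_nonWanderingSet_le f hδ
  obtain ⟨δ', hδ', hclose⟩ := exists_dist_lt_of_quotient_dist_lt hπ hfib hδ
  have hshift := exists_iterate_disjoint_visits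
    (P := fun x => ∀ p ∈ nonWanderingSet f, δ ≤ dist x p) hM
  choose t ht hdisj using hshift
  set L := M * M with hL
  refine ⟨δ', hδ', L, ((L + 1) * (n ^ (n * M) * (hfin.toFinset.card + 1))) ^ n, fun N => ?_⟩
  obtain ⟨E, -, hE, hEcard, -⟩ := exists_isDynSep_card_eq_dynSepMax hε
    (bddAbove_card_isDynSep f.continuous N hε univ)
  -- All points are pulled back by `f ^ L`; the coordinate `i₁` is then pushed forward so that its
  -- excursions away from the non-wandering set never coincide with those of the coordinate `i₀`.
  let w : X → X := f.symm^[L]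
  have hw : ∀ x, f^[L] (w x) = x := (f.right_inv : Function.RightInverse _ _).iterate L
  let ζ : (Fin n → X) → Fin n → X := fun x i =>
    f^[if i = i₁ then t (w (x i₀)) (w (x i₁)) else 0] (w (x i))
  have hζ : ∀ x j, ¬ ((∀ p ∈ nonWanderingSet f, δ ≤ dist (f^[j] (ζ x i₀)) p) ∧
      ∀ p ∈ nonWanderingSet f, δ ≤ dist (f^[j] (ζ x i₁)) p) := by
    intro x j
    simpa [ζ, hi] using hdisj (w (x i₀)) (w (x i₁)) j
  let V := Fintype.piFinset fun _ : Fin n => E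
  obtain ⟨F, hFY, hF, -, hspan⟩ := exists_isDynSep_card_eq_dynSepMax hδ'
    (hb (N + L) δ' hδ' ((fun x => π (ζ x)) '' V))
  have hFcard : F.card ≤ dynSepMax g univ (N + L) δ' :=
    le_csSup (hb (N + L) δ' hδ' univ) ⟨F, subset_univ _, hF, rfl⟩
  have hspan' : ∀ x, ∃ s, x ∈ V →
      s ∈ F ∧ ∀ j < N + L, dist (g^[j] (π (ζ x))) (g^[j] s) < δ' := by
    intro x
    by_cases hx : x ∈ V
    · obtain ⟨s, hs, h⟩ := hspan _ (mem_image_of_mem _ hx)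
      exact ⟨s, fun _ => ⟨hs, h⟩⟩
    · exact ⟨π x, fun h => absurd h hx⟩
  choose e he using hspan'
  have hVcard : V.card = dynSepMax f univ N ε ^ n := by simp [V, hEcard]
  rw [← hVcard]
  refine (Finset.card_le_mul_card_image_of_maps_to (fun x hx => (he x hx).1) _
    fun s hs => ?_).trans (Nat.mul_le_mul_left _ hFcard)
  obtain ⟨x₀, -, rfl⟩ := hFY hs
  let T := (Finset.range (N + L)).filter
    fun j => ∃ i, ∀ p ∈ nonWanderingSet f, 2 * δ ≤ dist (f^[j] (ζ x₀ i)) p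
  have hTcard : T.card ≤ n * M := by
    have hsub : T ⊆ Finset.univ.biUnion fun i => (hM (ζ x₀ i)).1.toFinset := by
      intro j hj
      obtain ⟨i, hij⟩ := (Finset.mem_filter.1 hj).2
      refine Finset.mem_biUnion.2 ⟨i, Finset.mem_univ i, ?_⟩
      rw [Finite.mem_toFinset]
      exact fun p hp => by linarith [hij p hp]
    refine (Finset.card_le_card hsub).trans ((Finset.card_biUnion_le_card_mul _ _ M
      fun i _ => ?_).trans (by simp))
    rw [← ncard_eq_toFinset_card _ (hM (ζ x₀ i)).1]
    exact (hM _).2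
  let Good : X → Prop := fun y =>
    (∀ j ∈ T, ∃ i, dist (f^[j] y) (f^[j] (ζ x₀ i)) < δ) ∧
      ∀ j < N + L, j ∉ T → ∃ p ∈ hfin.toFinset, dist (f^[j] y) p < 3 * δ
  let W := (Finset.range (L + 1)).biUnion fun k => E.filter fun y => Good (f^[k] (w y))
  have hWcard : W.card ≤ (L + 1) * (n ^ (n * M) * (hfin.toFinset.card + 1)) := by
    refine (Finset.card_biUnion_le_card_mul _ _ (n ^ (n * M) * (hfin.toFinset.card + 1))
      fun k hk => ?_).trans (by simp)
    have hkL : k ≤ L := Nat.lt_succ_iff.1 (Finset.mem_range.1 hk)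
    have hback : ∀ j y, f^[j + (L - k)] (f^[k] (w y)) = f^[j] y := by
      intro j y
      rw [← Function.iterate_add_apply, add_assoc, Nat.sub_add_cancel hkL,
        Function.iterate_add_apply, hw]
    have hinj : Function.Injective fun y => f^[k] (w y) := by
      intro y y' hyy
      have := congrArg (f^[0 + (L - k)]) hyy
      simpa only [hback, Function.iterate_zero, id] using this
    rw [← Finset.card_image_of_injective _ hinj]
    refine (card_le_of_shadowing (ε := ε) (N := N + L) hδ hδε hδr hΩ
      (fun a b hab => hfη (hab.trans_le hδη)) ?_ (ζ x₀) T ?_ ?_).trans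
      (Nat.mul_le_mul_right _ (Nat.pow_le_pow_right i₀.pos hTcard))
    · intro a ha b hb hab
      simp only [Finset.coe_image, mem_image, Finset.mem_coe, Finset.mem_filter] at ha hb
      obtain ⟨y, ⟨hy, -⟩, rfl⟩ := ha
      obtain ⟨y', ⟨hy', -⟩, rfl⟩ := hb
      obtain ⟨j, hj, hd⟩ := hE y hy y' hy' fun h => hab (h ▸ rfl)
      exact ⟨j + (L - k), by omega, by rwa [hback, hback]⟩
    · intro a ha
      obtain ⟨y, hy, rfl⟩ := Finset.mem_image.1 ha
      exact (Finset.mem_filter.1 hy).2.1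
    · intro a ha
      obtain ⟨y, hy, rfl⟩ := Finset.mem_image.1 ha
      exact (Finset.mem_filter.1 hy).2.2
  have hsub : (V.filter fun x => e x = π (ζ x₀)) ⊆ Fintype.piFinset fun _ : Fin n => W := by
    intro x hx
    obtain ⟨hxV, hxe⟩ := Finset.mem_filter.1 hx
    have hclose' : ∀ j < N + L, (∀ i, ∃ k, dist (f^[j] (ζ x i)) (f^[j] (ζ x₀ k)) < δ) ∨
        ∀ i k, dist (f^[j] (ζ x₀ i)) (f^[j] (ζ x₀ k)) < δ ∧
          dist (f^[j] (ζ x i)) (f^[j] (ζ x k)) < δ := by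
      intro j hj
      have := (he x hxV).2 j hj
      rw [hxe, iterate_apply_of_power_semiconj hg, iterate_apply_of_power_semiconj hg,
        dist_comm] at this
      exact hclose _ _ this
    refine Fintype.mem_piFinset.2 fun i => Finset.mem_biUnion.2
      ⟨if i = i₁ then t (w (x i₀)) (w (x i₁)) else 0, ?_,
        Finset.mem_filter.2 ⟨Fintype.mem_piFinset.1 hxV i, ?_, ?_⟩⟩
    · rw [Finset.mem_range]
      split_ifs
      · exact ht _ _
      · omega
    · intro j hj
      obtain ⟨hjN, k, hk⟩ := Finset.mem_filter.1 hj
      rcases hclose' j (Finset.mem_range.1 hjN) with h | h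
      · exact h i
      · refine absurd ⟨fun p hp => ?_, fun p hp => ?_⟩ (hζ x₀ j)
        · linarith [hk p hp, (h k i₀).1,
            dist_triangle (f^[j] (ζ x₀ k)) (f^[j] (ζ x₀ i₀)) p]
        · linarith [hk p hp, (h k i₁).1,
            dist_triangle (f^[j] (ζ x₀ k)) (f^[j] (ζ x₀ i₁)) p]
    · intro j hjN hj
      rcases hclose' j hjN with h | h
      · obtain ⟨k, hk⟩ := h i
        have hnear : ∃ p ∈ nonWanderingSet f, dist (f^[j] (ζ x₀ k)) p < 2 * δ := by
          by_contra! hcon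
          exact hj (Finset.mem_filter.2 ⟨Finset.mem_range.2 hjN, k, hcon⟩)
        obtain ⟨p, hp, hd⟩ := hnear
        refine ⟨p, hfin.mem_toFinset.2 hp, ?_⟩
        have := dist_triangle (f^[j] (ζ x i)) (f^[j] (ζ x₀ k)) p
        change dist (f^[j] (ζ x i)) p < 3 * δ
        linarith
      · have hnear : ∃ k, ∃ p ∈ nonWanderingSet f, dist (f^[j] (ζ x k)) p < δ := by
          by_contra! hcon
          exact hζ x j ⟨hcon i₀, hcon i₁⟩
        obtain ⟨k, p, hp, hd⟩ := hnear
        refine ⟨p, hfin.mem_toFinset.2 hp, ?_⟩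
        have := dist_triangle (f^[j] (ζ x i)) (f^[j] (ζ x k)) p
        change dist (f^[j] (ζ x i)) p < 3 * δ
        linarith [(h i k).2]
  refine (Finset.card_le_card hsub).trans ?_
  rw [Fintype.card_piFinset_const]
  exact Nat.pow_le_pow_left hWcard n

/-- The point of the symmetric product underlying a nonempty tuple. -/
def symProdMk {X : Type*} [MetricSpace X] {n : ℕ} (hn : 0 < n) (z : Fin n → X) : symProd X n :=
  ⟨⟨⟨range z, (finite_range z).isCompact⟩, ⟨z ⟨0, hn⟩, mem_range_self _⟩⟩, finite_range z, by
    change (range z).ncard ≤ n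
    rw [← image_univ]
    exact (ncard_image_le finite_univ).trans (by simp [ncard_univ])⟩

theorem coe_symProdMk {X : Type*} [MetricSpace X] {n : ℕ} (hn : 0 < n) (z : Fin n → X) :
    ((symProdMk hn z : symProd X n) : Set X) = range z := rfl

theorem symProd_ext {X : Type*} [MetricSpace X] {n : ℕ} {A B : symProd X n}
    (h : (A : Set X) = B) : A = B :=
  Subtype.ext (SetLike.coe_injective h)

theorem symProdMk_surjective {X : Type*} [MetricSpace X] {n : ℕ} (hn : 0 < n) :
    Function.Surjective (symProdMk hn : (Fin n → X) → symProd X n) := by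
  intro A
  have hA : (A : Set X).Finite := A.2.1
  obtain ⟨a, ha⟩ : (A : Set X).Nonempty := A.1.nonempty
  have : Nonempty (A : Set X) := ⟨⟨a, ha⟩⟩
  have : Fintype (A : Set X) := hA.fintype
  have hle : Fintype.card (A : Set X) ≤ Fintype.card (Fin n) := by
    rw [← Nat.card_eq_fintype_card, Fintype.card_fin]
    exact A.2.2
  obtain ⟨φ⟩ := Function.Embedding.nonempty_of_card_le hle
  refine ⟨fun i => (Function.invFun φ i : (A : Set X)), symProd_ext ?_⟩
  rw [coe_symProdMk]
  ext x
  constructor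
  · rintro ⟨i, rfl⟩
    exact (Function.invFun φ i).2
  · intro hx
    exact ⟨φ ⟨x, hx⟩, by simp [Function.leftInverse_invFun φ.injective _]⟩

theorem continuous_symProdMk {X : Type*} [MetricSpace X] {n : ℕ} (hn : 0 < n) :
    Continuous (symProdMk hn : (Fin n → X) → symProd X n) := by
  refine LipschitzWith.continuous (K := 1) fun z z' => ?_
  rw [ENNReal.coe_one, one_mul]
  change Metric.hausdorffEDist (range z) (range z') ≤ edist z z'
  refine Metric.hausdorffEDist_le_of_mem_edist ?_ ?_
  · rintro _ ⟨i, rfl⟩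
    exact ⟨z' i, mem_range_self i, edist_le_pi_edist z z' i⟩
  · rintro _ ⟨i, rfl⟩
    exact ⟨z i, mem_range_self i, edist_comm (z' i) (z i) ▸ edist_le_pi_edist z z' i⟩

theorem symProdMap_symProdMk {X : Type*} [MetricSpace X] {f : X → X} (hf : Continuous f) {n : ℕ}
    (hn : 0 < n) (z : Fin n → X) :
    symProdMap hf n (symProdMk hn z) = symProdMk hn fun i => f (z i) :=
  symProd_ext (range_comp f z).symm

/-- Main theorem (suspension part): for a homeomorphism `f` of a compact metric space
with finite non-wandering set and `n ≥ 2`, the polynomial entropy of the induced map on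
the `n`-fold symmetric product suspension equals `n · h_pol(f)`.  The suspension is
realized as any compact metric quotient `q : F_n(X) → S` collapsing exactly `F₁(X)`. -/
theorem polEntropy_suspension {X : Type*} [MetricSpace X] [CompactSpace X]
    (f : X ≃ₜ X) (hfin : (nonWanderingSet (f : X → X)).Finite)
    (n : ℕ) (hn : 2 ≤ n)
    {S : Type*} [MetricSpace S] [CompactSpace S]
    (q : symProd X n → S) (hq : IsQuotientMap q)
    (hfib : ∀ A B : symProd X n, q A = q B ↔
      A = B ∨ ((A : Set X).Subsingleton ∧ (B : Set X).Subsingleton))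
    (g : S → S) (hg : g ∘ q = q ∘ symProdMap f.continuous n) :
    polEntropy g = n * polEntropy (f : X → X) := by
  have hn0 : 0 < n := by omega
  have hπ : Continuous (q ∘ symProdMk hn0) := hq.continuous.comp (continuous_symProdMk hn0)
  have hsurj : Function.Surjective (q ∘ symProdMk hn0) :=
    hq.surjective.comp (symProdMk_surjective hn0)
  have hgπ : ∀ z, g ((q ∘ symProdMk hn0) z) = (q ∘ symProdMk hn0) fun i => f (z i) := fun z => by
    rw [Function.comp_apply, Function.comp_apply, ← symProdMap_symProdMk f.continuous]
    exact congrFun hg _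
  have hfibπ : ∀ z z', (q ∘ symProdMk hn0) z = (q ∘ symProdMk hn0) z' →
      range z = range z' ∨ ((range z).Subsingleton ∧ (range z').Subsingleton) := fun z z' h =>
    ((hfib _ _).1 h).imp_left fun h => congrArg (fun A : symProd X n => (A : Set X)) h
  refine le_antisymm (polEntropy_le_mul_of_dynSepMax_le_pow fun ε hε => ?_)
    (mul_polEntropy_le_of_dynSepMax_pow_le fun ε hε => exists_dynSepMax_pow_le f hfin
      (i₀ := ⟨0, hn0⟩) (i₁ := ⟨1, hn⟩) (by simp) hπ hfibπ hgπ (fun N ε hε Y => ?_) hε)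
  · obtain ⟨δ, hδ, h⟩ := exists_card_le_dynSepMax_pow f.continuous hπ hsurj hgπ hε
    refine ⟨δ, hδ, fun N => csSup_le' ?_⟩
    rintro k ⟨F, -, hF, rfl⟩
    exact h N F hF
  · obtain ⟨δ, -, h⟩ := exists_card_le_dynSepMax_pow f.continuous hπ hsurj hgπ hε
    refine ⟨dynSepMax f univ N δ ^ n, ?_⟩
    rintro k ⟨F, -, hF, rfl⟩
    exact h N F hF
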